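/- Let G be a T1 topological locally compact fan loop satisfying Condition (3.5.2) with compact subgroup N₀. Let f, φ ∈ C₀₀⁺(G) with φ not identically zero, and let ω ∈ Υ(G,N₀). Then (f : φ) ≤ (f : ω)·(ω : φ). -/

import Mathlib

/-- The nucleus of a magma: elements associating with all pairs in all three positions. -/
def nucleus (G : Type*) [Mul G] : Set G :=
  {a | (∀ b c : G, (a * b) * c = a * (b * c)) ∧ (∀ b c : G, (b * a) * c = b * (a * c)) ∧
       (∀ b c : G, (b * c) * a = b * (c * a))}

/-- The center of a magma: commuting elements of the nucleus. -/
def centrum (G : Type*) [Mul G] : Set G :=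
  {a | ∀ b : G, a * b = b * a} ∩ nucleus G

/-- A (nonassociative) fan loop. -/
class FanLoop (G : Type*) extends Mul G, One G where
  /-- left division: `ldiv a b` is the unique `x` with `a * x = b`. -/
  ldiv : G → G → G
  /-- right division: `rdiv b a` is the unique `y` with `y * a = b`. -/
  rdiv : G → G → G
  one_mul : ∀ a : G, 1 * a = a
  mul_one : ∀ a : G, a * 1 = a
  mul_ldiv : ∀ a b : G, a * ldiv a b = b
  ldiv_unique : ∀ a x b : G, a * x = b → x = ldiv a b
  rdiv_mul : ∀ a b : G, rdiv b a * a = b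
  rdiv_unique : ∀ a y b : G, y * a = b → y = rdiv b a
  t : G → G → G → G
  p : G → G → G → G
  t_mem : ∀ a b c : G, t a b c ∈ nucleus G
  p_mem : ∀ a b c : G, p a b c ∈ nucleus G
  t_spec : ∀ a b c : G, (a * b) * c = t a b c * (a * (b * c))
  p_spec : ∀ a b c : G, (a * b) * c = (a * (b * c)) * p a b c

namespace FanLoop
variable {G : Type*} [FanLoop G]
/-- the inverse `x⁻¹ = x \ e` of an element (used for elements of the nucleus,
where it is the two-sided group inverse). -/
def linv (x : G) : G := ldiv x 1
end FanLoop

open FanLoop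

/-- The covering ratio `(f : φ)` of Haar-functional theory on a fan loop. -/
noncomputable def covRatio {G : Type*} [FanLoop G] (f φ : G → ℝ) : ℝ :=
  sInf {r : ℝ | ∃ (m : ℕ) (b : Fin m → G) (c : Fin m → ℝ),
    (∀ j, 0 < c j) ∧ (∀ x : G, f x ≤ ∑ j, c j * φ (b j * x)) ∧ r = ∑ j, c j}

open MeasureTheory MeasureTheory.Measure Topology in
theorem haar_pres {T : Type*} [Group T] [TopologicalSpace T] [IsTopologicalGroup T]
    [CompactSpace T] [MeasurableSpace T] [BorelSpace T] (μ : Measure T) [IsProbabilityMeasure μ]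
    [IsHaarMeasure μ] (c : T →* T) (hc : Continuous c) (hs : Function.Surjective c) (s : T) :
    μ.map (fun γ => c γ * s) = μ := by
  have hcont : Continuous (fun γ => c γ * s) := hc.mul continuous_const
  have hprob : IsProbabilityMeasure (μ.map (fun γ => c γ * s)) :=
    isProbabilityMeasure_map hcont.measurable.aemeasurable
  have hinv : IsMulLeftInvariant (μ.map (fun γ => c γ * s)) := by
    refine ⟨fun h => ?_⟩
    obtain ⟨g, rfl⟩ := hs h
    rw [map_map (continuous_const_mul (c g)).measurable hcont.measurable]
    conv_rhs => rw [← map_mul_left_eq_self μ g]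
    rw [map_map hcont.measurable (continuous_const_mul g).measurable]
    congr 1
    funext γ
    simp [mul_assoc]
  have : IsHaarMeasure (μ.map (fun γ => c γ * s)) :=
    isHaarMeasure_of_isCompact_nonempty_interior _ Set.univ isCompact_univ (by simp)
      (by simp) (by simp)
  exact isHaarMeasure_eq_of_isProbabilityMeasure _ _

open MeasureTheory in
theorem avg_approx {T X : Type*} [TopologicalSpace T] [CompactSpace T] [MeasurableSpace T]
    [BorelSpace T] [TopologicalSpace X] [CompactSpace X] (μ : Measure T) [IsProbabilityMeasure μ]
    (F : C(T, C(X, ℝ))) (ε : ℝ) (hε : 0 < ε) :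
    ∃ (ι : Type) (_ : Fintype ι) (w : ι → ℝ) (g : ι → T), (∀ i, 0 ≤ w i) ∧ ∑ i, w i = 1 ∧
      ∀ x, ∫ γ, F γ x ∂μ ≤ ∑ i, w i * F (g i) x + ε := by
  have hint : Integrable (fun γ => F γ) μ :=
    F.continuous.integrable_of_hasCompactSupport (HasCompactSupport.of_compactSpace _)
  have hmem : (∫ γ, F γ ∂μ) ∈ closure (convexHull ℝ (Set.range F)) := by
    refine Convex.integral_mem (convex_convexHull ℝ _).closure isClosed_closure ?_ hint
    exact Filter.Eventually.of_forall fun γ => subset_closure (subset_convexHull ℝ _ ⟨γ, rfl⟩)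
  obtain ⟨h, hh, hd⟩ := Metric.mem_closure_iff.1 hmem ε hε
  rw [convexHull_eq] at hh
  obtain ⟨ι, t, w, z, hw, hw1, hz, rfl⟩ := hh
  have hz' : ∀ i : t, ∃ γ, F γ = z i := fun i => hz i i.2
  choose g hg using hz'
  refine ⟨t, inferInstance, fun i => w i, g, fun i => hw i i.2, ?_, fun x => ?_⟩
  · rw [Finset.sum_coe_sort t w, hw1]
  · rw [← ContinuousMap.integral_apply hint]
    have h1 := (ContinuousMap.dist_lt_iff hε).1 hd x
    rw [Real.dist_eq] at h1
    have h2 := (abs_lt.1 h1).2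
    rw [Finset.centerMass_eq_of_sum_1 _ _ hw1] at h2
    have h3 : (∑ i ∈ t, w i • z i) x = ∑ i : t, w i * F (g i) x := by
      rw [ContinuousMap.sum_apply, ← Finset.sum_coe_sort t]
      refine Finset.sum_congr rfl fun i _ => ?_
      rw [hg]; rfl
    rw [h3] at h2
    linarith

/-- The set of total weights of coverings. -/
def covSet {G : Type*} [FanLoop G] (f φ : G → ℝ) : Set ℝ :=
  {r : ℝ | ∃ (m : ℕ) (b : Fin m → G) (c : Fin m → ℝ),
    (∀ j, 0 < c j) ∧ (∀ x : G, f x ≤ ∑ j, c j * φ (b j * x)) ∧ r = ∑ j, c j}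

theorem covSet_mk {G : Type*} [FanLoop G] {f φ : G → ℝ} {ι : Type*} [Fintype ι] (b : ι → G)
    (c : ι → ℝ) (hc : ∀ i, 0 ≤ c i) (h : ∀ x, f x ≤ ∑ i, c i * φ (b i * x)) :
    ∑ i, c i ∈ covSet f φ := by
  classical
  have key : ∀ u : ι → ℝ, (∀ i, c i = 0 → u i = 0) →
      ∑ i, u i = ∑ i : {i // 0 < c i}, u i := by
    intro u hu
    rw [← Finset.sum_subtype (Finset.univ.filter fun i => 0 < c i) (by simp) u]
    symm
    apply Finset.sum_subset (Finset.subset_univ _)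
    intro i _ hi
    apply hu
    simp only [Finset.mem_filter, Finset.mem_univ, true_and, not_lt] at hi
    exact le_antisymm hi (hc i)
  let e := (Fintype.equivFin {i // 0 < c i}).symm
  refine ⟨_, fun j => b (e j), fun j => c (e j), fun j => (e j).2, fun x => ?_, ?_⟩
  · refine (h x).trans (le_of_eq ?_)
    rw [key _ (fun i hi => by simp [hi])]
    exact (e.sum_comp (fun i : {i // 0 < c i} => c i * φ (b i * x))).symm
  · rw [key _ (fun i hi => hi)]
    exact (e.sum_comp (fun i : {i // 0 < c i} => c i)).symm

theorem covSet_nonneg {G : Type*} [FanLoop G] {f φ : G → ℝ} {r : ℝ} (h : r ∈ covSet f φ) :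
    0 ≤ r := by
  obtain ⟨m, b, c, hc, -, rfl⟩ := h
  exact Finset.sum_nonneg fun j _ => (hc j).le

theorem cover_one {G : Type*} [TopologicalSpace G] [FanLoop G]
    (hm : Continuous fun q : G × G => q.1 * q.2) (K : Set G) (hK : IsCompact K) (ψ : G → ℝ)
    (hψ : Continuous ψ) (hψ0 : ∀ x, 0 ≤ ψ x) (hne : ψ ≠ 0) :
    ∃ (m : ℕ) (b : Fin m → G) (c : Fin m → ℝ),
    (∀ j, 0 < c j) ∧ (∀ x ∈ K, 1 ≤ ∑ j, c j * ψ (b j * x)) := by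
  obtain ⟨y, hy⟩ := Function.ne_iff.1 hne
  have hy : 0 < ψ y := lt_of_le_of_ne (hψ0 y) (Ne.symm hy)
  have hcont : ∀ a : G, Continuous fun x => ψ (a * x) := fun a =>
    hψ.comp (hm.comp (continuous_const.prodMk continuous_id))
  obtain ⟨s, hs⟩ := hK.elim_finite_subcover (fun g : G => {x | ψ y / 2 < ψ (rdiv y g * x)})
    (fun g => isOpen_lt continuous_const (hcont _))
    (fun x _ => Set.mem_iUnion.2 ⟨x, by
      simp only [Set.mem_setOf_eq, rdiv_mul]; linarith⟩)
  let e := s.equivFin.symm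
  refine ⟨_, fun j => rdiv y (e j), fun _ => 2 / ψ y, fun j => by positivity, fun x hx => ?_⟩
  have := hs hx
  simp only [Set.mem_iUnion, Set.mem_setOf_eq] at this
  obtain ⟨g, hg, hgx⟩ := this
  rw [e.sum_comp (fun i : s => 2 / ψ y * ψ (rdiv y i * x))]
  refine le_trans ?_ (Finset.single_le_sum (f := fun i : s => 2 / ψ y * ψ (rdiv y i * x))
    (fun i _ => mul_nonneg (by positivity) (hψ0 _)) (Finset.mem_univ ⟨g, hg⟩))
  show 1 ≤ 2 / ψ y * ψ (rdiv y g * x)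
  rw [div_mul_eq_mul_div, le_div_iff₀ hy]
  linarith

theorem covSet_nonempty {G : Type*} [TopologicalSpace G] [FanLoop G]
    (hm : Continuous fun q : G × G => q.1 * q.2) (f ψ : G → ℝ) (hf : Continuous f)
    (hfs : HasCompactSupport f)
    (hψ : Continuous ψ) (hψ0 : ∀ x, 0 ≤ ψ x) (hne : ψ ≠ 0) : (covSet f ψ).Nonempty := by
  obtain ⟨m, b, c, hc, h⟩ := cover_one hm _ hfs ψ hψ hψ0 hne
  obtain ⟨C, hC⟩ := hf.bounded_above_of_compact_support hfs
  have hC0 : 0 ≤ C := (norm_nonneg _).trans (hC 1)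
  refine ⟨_, covSet_mk b (fun j => C * c j) (fun j => mul_nonneg hC0 (hc j).le) fun x => ?_⟩
  simp only [mul_assoc]
  rw [← Finset.mul_sum]
  by_cases hx : x ∈ tsupport f
  · have := le_mul_of_one_le_right hC0 (h x hx)
    exact ((le_abs_self _).trans (hC x)).trans this
  · rw [image_eq_zero_of_notMem_tsupport hx]
    exact mul_nonneg hC0 (Finset.sum_nonneg fun j _ => mul_nonneg (hc j).le (hψ0 _))

theorem fl_lcancel {G : Type*} [FanLoop G] {a x y : G} (h : a * x = a * y) : x = y :=
  (ldiv_unique a x _ h).trans (ldiv_unique a y _ rfl).symm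

theorem fl_rcancel {G : Type*} [FanLoop G] {a x y : G} (h : x * a = y * a) : x = y :=
  (rdiv_unique a x _ h).trans (rdiv_unique a y _ rfl).symm

universe uG

theorem exists_grp {G : Type uG} [TopologicalSpace G] [T1Space G] [FanLoop G]
    (hm : Continuous fun q : G × G => q.1 * q.2)
    (hl : Continuous fun q : G × G => ldiv q.1 q.2)
    (hr : Continuous fun q : G × G => rdiv q.1 q.2)
    (N₀ : Set G) (hcpt : IsCompact N₀) (hsub : N₀ ⊆ nucleus G) (h1 : (1 : G) ∈ N₀)
    (hmulc : ∀ x ∈ N₀, ∀ y ∈ N₀, x * y ∈ N₀) (hinvc : ∀ x ∈ N₀, ldiv x 1 ∈ N₀)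
    (ht : ∀ a b c : G, t a b c ∈ N₀) :
    ∃ (T : Type uG) (_ : Group T) (_ : TopologicalSpace T) (_ : IsTopologicalGroup T)
      (_ : CompactSpace T) (i : T → G), Continuous i ∧ (∀ x, i x ∈ N₀) ∧
      (∀ x y, i (x * y) = i x * i y) ∧
      (∀ a : G, ∃ c : T →* T, Continuous c ∧ Function.Surjective c ∧
        ∀ τ, a * i τ = i (c τ) * a) ∧
      (∀ a b x : G, ∃ s : T, a * (b * x) = i s * ((a * b) * x)) := by
  haveI : T2Space G := by
    rw [t2_iff_isClosed_diagonal]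
    have : Set.diagonal G = (fun q : G × G => ldiv q.1 q.2) ⁻¹' {1} := by
      ext ⟨a, b⟩
      simp only [Set.mem_diagonal_iff, Set.mem_preimage, Set.mem_singleton_iff]
      constructor
      · rintro rfl
        exact (ldiv_unique a 1 a (FanLoop.mul_one a)).symm
      · intro h
        have := mul_ldiv a b
        rwa [h, FanLoop.mul_one] at this
    rw [this]
    exact isClosed_singleton.preimage hl
  -- nucleus associativity
  have A1 : ∀ {x}, x ∈ N₀ → ∀ b c : G, (x * b) * c = x * (b * c) := fun hx => (hsub hx).1
  have A2 : ∀ {x}, x ∈ N₀ → ∀ b c : G, (b * x) * c = b * (x * c) := fun hx => (hsub hx).2.1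
  have A3 : ∀ {x}, x ∈ N₀ → ∀ b c : G, (b * c) * x = b * (c * x) := fun hx => (hsub hx).2.2
  have invl : ∀ {x}, x ∈ N₀ → ldiv x 1 * x = 1 := by
    intro x hx
    apply fl_lcancel (a := x)
    rw [← A1 hx, mul_ldiv, FanLoop.one_mul, FanLoop.mul_one]
  have invr : ∀ x : G, x * ldiv x 1 = 1 := fun x => mul_ldiv x 1
  let S : Set G := {τ | τ ∈ N₀ ∧ ∀ a, rdiv (a * τ) a ∈ N₀}
  have S_iff : ∀ τ, τ ∈ S ↔ τ ∈ N₀ ∧ ∀ a, ∃ n ∈ N₀, a * τ = n * a := by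
    intro τ
    refine and_congr_right fun _ => forall_congr' fun a => ⟨fun h => ⟨_, h, ?_⟩, ?_⟩
    · exact (rdiv_mul a _).symm
    · rintro ⟨n, hn, h⟩
      rwa [← rdiv_unique a n _ h.symm]
  have Smul : ∀ x ∈ S, ∀ y ∈ S, x * y ∈ S := by
    intro x hx y hy
    rw [S_iff] at hx hy ⊢
    refine ⟨hmulc x hx.1 y hy.1, fun a => ?_⟩
    obtain ⟨n, hn, h⟩ := hx.2 a
    obtain ⟨k, hk, h'⟩ := hy.2 a
    refine ⟨n * k, hmulc n hn k hk, ?_⟩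
    rw [← A3 hy.1, h, A3 hy.1, h', A1 hn]
  have Sone : (1 : G) ∈ S := by
    rw [S_iff]
    exact ⟨h1, fun a => ⟨1, h1, by rw [FanLoop.mul_one, FanLoop.one_mul]⟩⟩
  have Sinv : ∀ x ∈ S, ldiv x 1 ∈ S := by
    intro x hx
    rw [S_iff] at hx ⊢
    refine ⟨hinvc x hx.1, fun a => ?_⟩
    obtain ⟨n, hn, h⟩ := hx.2 a
    refine ⟨ldiv n 1, hinvc n hn, ?_⟩
    apply fl_rcancel (a := x)
    rw [A3 hx.1, invl hx.1, A1 (hinvc n hn), h, ← A1 (hinvc n hn), invl hn,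
      FanLoop.one_mul, FanLoop.mul_one]
  have Sconj : ∀ x ∈ S, ∀ a n : G, a * x = n * a → n ∈ S := by
    intro x hx a n h
    rw [S_iff] at hx ⊢
    have hn : n ∈ N₀ := by
      obtain ⟨n', hn', h'⟩ := hx.2 a
      rwa [fl_rcancel (h.symm.trans h')]
    refine ⟨hn, fun b => ?_⟩
    obtain ⟨k, hk, h'⟩ := hx.2 (b * a)
    refine ⟨k, hk, ?_⟩
    apply fl_rcancel (a := a)
    rw [A2 hn, ← h, ← A3 hx.1, h', A1 hk]
  have St : ∀ b c d : G, t b c d ∈ S := by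
    intro b c d
    rw [S_iff]
    refine ⟨ht b c d, fun a => ?_⟩
    have e1 : ((a * b) * c) * d = (t (a * b) c d * t a b (c * d)) * (a * (b * (c * d))) := by
      rw [t_spec (a * b) c d, t_spec a b (c * d), A1 (ht _ _ _)]
    have e2 : ((a * b) * c) * d =
        (t a b c * t a (b * c) d) * ((a * t b c d) * (b * (c * d))) := by
      rw [t_spec a b c, A1 (ht _ _ _), t_spec a (b * c) d, t_spec b c d, A1 (ht _ _ _),
        A2 (ht _ _ _)]
    have hu := hmulc _ (ht a b c) _ (ht a (b * c) d)
    have hv := hmulc _ (ht (a * b) c d) _ (ht a b (c * d))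
    generalize t a b c * t a (b * c) d = u at *
    generalize t (a * b) c d * t a b (c * d) = v at *
    refine ⟨ldiv u 1 * v, hmulc _ (hinvc _ hu) _ hv, ?_⟩
    apply fl_rcancel (a := b * (c * d))
    apply fl_lcancel (a := u)
    rw [← e2, e1, A1 (hmulc _ (hinvc _ hu) _ hv), ← A1 hu, ← A1 hu, invr, FanLoop.one_mul]
  have Scl : IsClosed S := by
    have : S = N₀ ∩ ⋂ a, (fun τ => rdiv (a * τ) a) ⁻¹' N₀ := by
      ext τ; simp [S]
    rw [this]
    refine hcpt.isClosed.inter (isClosed_iInter fun a => hcpt.isClosed.preimage ?_)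
    exact hr.comp ((hm.comp (continuous_const.prodMk continuous_id)).prodMk continuous_const)
  have Scpt : IsCompact S := hcpt.of_isClosed_subset Scl fun x hx => hx.1
  letI : Mul S := ⟨fun x y => ⟨x.1 * y.1, Smul _ x.2 _ y.2⟩⟩
  letI : One S := ⟨⟨1, Sone⟩⟩
  letI : Inv S := ⟨fun x => ⟨ldiv x.1 1, Sinv _ x.2⟩⟩
  letI grp : Group S := Group.ofLeftAxioms
    (fun x y z => Subtype.ext (A1 x.2.1 _ _)) (fun x => Subtype.ext (FanLoop.one_mul _))
    (fun x => Subtype.ext (invl x.2.1))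
  have coe_mul : ∀ x y : S, ((x * y : S) : G) = x.1 * y.1 := fun _ _ => rfl
  haveI : IsTopologicalGroup S :=
    { continuous_mul := Continuous.subtype_mk (hm.comp
        ((continuous_subtype_val.comp continuous_fst).prodMk
          (continuous_subtype_val.comp continuous_snd))) _
      continuous_inv := Continuous.subtype_mk (hl.comp
        (continuous_subtype_val.prodMk continuous_const)) _ }
  haveI : CompactSpace S := isCompact_iff_compactSpace.1 Scpt
  refine ⟨S, grp, inferInstance, inferInstance, inferInstance, Subtype.val,
    continuous_subtype_val, fun x => x.2.1, coe_mul, ?_, ?_⟩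
  · intro a
    let c : G → S → S := fun a τ =>
      ⟨rdiv (a * τ.1) a, Sconj _ τ.2 a _ (rdiv_mul a _).symm⟩
    have hc : ∀ (a : G) (τ : S), a * (τ : G) = (c a τ : G) * a := fun a τ => (rdiv_mul a _).symm
    have hcm : ∀ x y, c a (x * y) = c a x * c a y := by
      intro x y
      apply Subtype.ext
      apply fl_rcancel (a := a)
      rw [← hc, coe_mul, coe_mul, ← A3 y.2.1, hc a x, A3 y.2.1, hc a y, A1 (c a x).2.1]
    refine ⟨MonoidHom.mk' (c a) hcm, ?_, ?_, hc a⟩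
    · exact Continuous.subtype_mk (hr.comp ((hm.comp (continuous_const.prodMk
        continuous_subtype_val)).prodMk continuous_const)) _
    · intro τ
      refine ⟨c (ldiv a 1) τ, ?_⟩
      show c a (c (ldiv a 1) τ) = τ
      apply Subtype.ext
      apply fl_rcancel (a := a * ldiv a 1)
      rw [← A1 (c a _).2.1, ← hc, A2 (c _ τ).2.1, ← hc, ← A3 τ.2.1, invr, FanLoop.one_mul,
        FanLoop.mul_one]
  · intro a b x
    refine ⟨⟨ldiv (t a b x) 1, Sinv _ (St a b x)⟩, ?_⟩
    show a * (b * x) = ldiv (t a b x) 1 * ((a * b) * x)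
    rw [t_spec, ← A1 (hinvc _ (ht a b x)), invl (ht a b x), FanLoop.one_mul]

open MeasureTheory MeasureTheory.Measure in
theorem cov_key {G : Type uG} [TopologicalSpace G] [FanLoop G]
    (hm : Continuous fun q : G × G => q.1 * q.2)
    (N₀ : Set G) (hsub : N₀ ⊆ nucleus G)
    {T : Type uG} [Group T] [TopologicalSpace T] [IsTopologicalGroup T]
    [CompactSpace T] (i : T → G) (hi : Continuous i) (hiN : ∀ x, i x ∈ N₀)
    (himul : ∀ x y, i (x * y) = i x * i y)
    (hconj : ∀ a : G, ∃ c : T →* T, Continuous c ∧ Function.Surjective c ∧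
        ∀ τ, a * i τ = i (c τ) * a)
    (hassoc : ∀ a b x : G, ∃ s : T, a * (b * x) = i s * ((a * b) * x))
    (f φ ω : G → ℝ) (hfs : HasCompactSupport f)
    (hφ : Continuous φ) (hφ0 : ∀ x : G, 0 ≤ φ x) (hφne : φ ≠ 0)
    (hωinv : ∀ a : G, ∀ γ ∈ N₀, ω (γ * a) = ω a) (C D : ℝ) (hC : C ∈ covSet f ω)
    (hD : D ∈ covSet ω φ) : sInf (covSet f φ) ≤ C * D := by
  obtain ⟨m, b, c, hc, hfω, rfl⟩ := hC
  obtain ⟨n, a, d, hd, hωφ, rfl⟩ := hD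
  borelize T
  let K₀ : TopologicalSpace.PositiveCompacts T := ⊤
  let μ : Measure T := haarMeasure K₀
  haveI : IsProbabilityMeasure μ := ⟨haarMeasure_self (K₀ := K₀)⟩
  have hcont : ∀ (g x : G), Continuous fun γ : T => φ ((i γ * g) * x) := fun g x =>
    hφ.comp (hm.comp ((hm.comp (hi.prodMk continuous_const)).prodMk continuous_const))
  have hint : ∀ (g x : G), Integrable (fun γ : T => φ ((i γ * g) * x)) μ := fun g x =>
    (hcont g x).integrable_of_hasCompactSupport (HasCompactSupport.of_compactSpace _)
  -- averaged inequality
  have havg : ∀ (g x : G), ω (g * x) ≤ ∑ k, d k * ∫ γ, φ ((i γ * (a k * g)) * x) ∂μ := by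
    intro g x
    have hterm : ∀ k, Integrable (fun γ : T => φ (a k * (i γ * (g * x)))) μ ∧
        ∫ γ, φ (a k * (i γ * (g * x))) ∂μ = ∫ γ, φ ((i γ * (a k * g)) * x) ∂μ := by
      intro k
      obtain ⟨cc, hcc, hsurj, hconj'⟩ := hconj (a k)
      obtain ⟨s, hs⟩ := hassoc (a k) g x
      have e : ∀ γ, a k * (i γ * (g * x)) = (i (cc γ * s) * (a k * g)) * x := by
        intro γ
        rw [← (hsub (hiN γ)).2.1, hconj', (hsub (hiN _)).1, hs, himul,
          ← (hsub (hiN (cc γ))).1, ← himul, (hsub (hiN (cc γ * s))).1]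
      have hcs : Continuous fun γ => cc γ * s := hcc.mul continuous_const
      simp only [e]
      refine ⟨((hcont (a k * g) x).comp hcs).integrable_of_hasCompactSupport
        (HasCompactSupport.of_compactSpace _), ?_⟩
      conv_rhs => rw [← haar_pres μ cc hcc hsurj s]
      rw [integral_map hcs.measurable.aemeasurable]
      rw [haar_pres μ cc hcc hsurj s]
      exact (hint _ _).aestronglyMeasurable
    calc ω (g * x) = ∫ γ : T, ω (g * x) ∂μ := by simp
      _ ≤ ∫ γ, ∑ k, d k * φ (a k * (i γ * (g * x))) ∂μ := by
        refine integral_mono (integrable_const _)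
          (integrable_finset_sum _ fun k _ => (hterm k).1.const_mul _) fun γ => ?_
        show ω (g * x) ≤ ∑ k, d k * φ (a k * (i γ * (g * x)))
        rw [← hωinv _ _ (hiN γ)]
        exact hωφ _
      _ = _ := by
        rw [integral_finset_sum _ fun k _ => (hterm k).1.const_mul _]
        refine Finset.sum_congr rfl fun k _ => ?_
        rw [integral_const_mul, (hterm k).2]
  let X := tsupport f
  haveI : CompactSpace X := isCompact_iff_compactSpace.1 hfs
  let F0 : C(T × X, ℝ) := ⟨fun q => ∑ j, c j * ∑ k, d k * φ ((i q.1 * (a k * b j)) * q.2.1), by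
    refine continuous_finset_sum _ fun j _ => continuous_const.mul
      (continuous_finset_sum _ fun k _ => continuous_const.mul (hφ.comp ?_))
    exact hm.comp ((hm.comp ((hi.comp continuous_fst).prodMk continuous_const)).prodMk
      (continuous_subtype_val.comp continuous_snd))⟩
  let F : C(T, C(X, ℝ)) := F0.curry
  have hF : ∀ γ x, F γ x = ∑ j, c j * ∑ k, d k * φ ((i γ * (a k * b j)) * x.1) :=
    fun _ _ => rfl
  have hfF : ∀ x : X, f x ≤ ∫ γ, F γ x ∂μ := by
    intro x
    simp only [hF]
    rw [integral_finset_sum _ fun j _ => (integrable_finset_sum _ fun k _ =>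
      (hint _ _).const_mul _).const_mul _]
    refine (hfω x).trans (Finset.sum_le_sum fun j _ => ?_)
    rw [integral_const_mul, integral_finset_sum _ fun k _ => (hint _ _).const_mul _]
    simp only [integral_const_mul]
    exact mul_le_mul_of_nonneg_left (havg _ _) (hc j).le
  obtain ⟨m', b', c', hc', h'⟩ := cover_one hm _ hfs φ hφ hφ0 hφne
  have hbdd : BddBelow (covSet f φ) := ⟨0, fun r hr => covSet_nonneg hr⟩
  have main : ∀ ε > 0, sInf (covSet f φ) ≤ (∑ j, c j) * (∑ k, d k) + ε * ∑ j, c' j := by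
    intro ε hε
    obtain ⟨ι, _, w, g, hw, hw1, hFw⟩ := avg_approx μ F ε hε
    have := covSet_mk (f := f) (φ := φ) (ι := (ι × Fin m × Fin n) ⊕ Fin m')
      (Sum.elim (fun q => i (g q.1) * (a q.2.2 * b q.2.1)) b')
      (Sum.elim (fun q => w q.1 * (c q.2.1 * d q.2.2)) (fun j => ε * c' j))
      (by
        rintro (q | j)
        · exact mul_nonneg (hw _) (mul_nonneg (hc _).le (hd _).le)
        · exact mul_nonneg hε.le (hc' j).le)
      (by
        intro x
        by_cases hx : x ∈ tsupport f
        · have e1 := (hfF ⟨x, hx⟩).trans (hFw ⟨x, hx⟩)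
          have e2 := h' x hx
          have e3 : ε ≤ ε * ∑ j, c' j * φ (b' j * x) := le_mul_of_one_le_right hε.le e2
          simp only [hF] at e1
          rw [Fintype.sum_sum_type]
          simp only [Sum.elim_inl, Sum.elim_inr, Fintype.sum_prod_type]
          refine e1.trans (add_le_add (le_of_eq ?_) (e3.trans (le_of_eq ?_)))
          · simp only [Finset.mul_sum, mul_assoc]
          · simp only [Finset.mul_sum, mul_assoc]
        · rw [image_eq_zero_of_notMem_tsupport hx]
          refine Finset.sum_nonneg fun q _ => mul_nonneg ?_ (hφ0 _)
          rcases q with q | j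
          · exact mul_nonneg (hw _) (mul_nonneg (hc _).le (hd _).le)
          · exact mul_nonneg hε.le (hc' j).le)
    refine (csInf_le hbdd this).trans (le_of_eq ?_)
    rw [Fintype.sum_sum_type]
    simp only [Sum.elim_inl, Sum.elim_inr, Fintype.sum_prod_type]
    simp only [← Finset.mul_sum, ← Finset.sum_mul, hw1, _root_.one_mul]
  have hE : 0 ≤ ∑ j, c' j := Finset.sum_nonneg fun j _ => (hc' j).le
  refine le_of_forall_pos_le_add fun δ hδ => ?_
  have := main (δ / (∑ j, c' j + 1)) (by positivity)
  refine this.trans (add_le_add le_rfl ?_)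
  rw [div_mul_eq_mul_div, div_le_iff₀ (by positivity)]
  nlinarith

/-- Lemma 3.6 of Ludkowski: submultiplicativity of the covering ratio through an
N₀-invariant function ω. -/
theorem covRatio_trans {G : Type*} [TopologicalSpace G] [T1Space G]
    [LocallyCompactSpace G] [FanLoop G]
    (hm : Continuous fun q : G × G => q.1 * q.2)
    (hl : Continuous fun q : G × G => ldiv q.1 q.2)
    (hr : Continuous fun q : G × G => rdiv q.1 q.2)
    -- Condition (3.5.2): a compact subgroup N₀ of the nucleus containing all t, p values
    (N₀ : Set G) (hcpt : IsCompact N₀) (hsub : N₀ ⊆ nucleus G) (h1 : (1 : G) ∈ N₀)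
    (hmulc : ∀ x ∈ N₀, ∀ y ∈ N₀, x * y ∈ N₀) (hinvc : ∀ x ∈ N₀, ldiv x 1 ∈ N₀)
    (ht : ∀ a b c : G, t a b c ∈ N₀) (hp : ∀ a b c : G, p a b c ∈ N₀)
    (f φ ω : G → ℝ)
    (hf : Continuous f) (hfs : HasCompactSupport f) (hf0 : ∀ x : G, 0 ≤ f x)
    (hφ : Continuous φ) (hφs : HasCompactSupport φ) (hφ0 : ∀ x : G, 0 ≤ φ x)
    (hφne : φ ≠ 0)
    -- ω ∈ Υ(G, N₀)
    (hω : Continuous ω) (hωs : HasCompactSupport ω) (hω0 : ∀ x : G, 0 ≤ ω x)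
    (hωne : ω ≠ 0) (hωinv : ∀ a : G, ∀ γ ∈ N₀, ω (γ * a) = ω a) :
    covRatio f φ ≤ covRatio f ω * covRatio ω φ := by
  obtain ⟨T, _, _, _, _, i, hi, hiN, himul, hconj, hassoc⟩ :=
    exists_grp hm hl hr N₀ hcpt hsub h1 hmulc hinvc ht
  have key : ∀ C ∈ covSet f ω, ∀ D ∈ covSet ω φ, sInf (covSet f φ) ≤ C * D :=
    fun C hC D hD => cov_key hm N₀ hsub i hi hiN himul hconj hassoc f φ ω hfs hφ hφ0 hφne
      hωinv C D hC hD
  have n1 : (covSet f ω).Nonempty := covSet_nonempty hm f ω hf hfs hω hω0 hωne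
  have n2 : (covSet ω φ).Nonempty := covSet_nonempty hm ω φ hω hωs hφ hφ0 hφne
  change sInf (covSet f φ) ≤ sInf (covSet f ω) * sInf (covSet ω φ)
  have p1 : 0 ≤ sInf (covSet f ω) := Real.sInf_nonneg fun r hr => covSet_nonneg hr
  have step : ∀ D ∈ covSet ω φ, sInf (covSet f φ) ≤ sInf (covSet f ω) * D := by
    intro D hD
    rw [mul_comm, ← smul_eq_mul, ← Real.sInf_smul_of_nonneg (covSet_nonneg hD)]
    refine le_csInf n1.smul_set ?_
    rintro _ ⟨C, hC, rfl⟩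
    simpa [mul_comm] using key C hC D hD
  rw [← smul_eq_mul, ← Real.sInf_smul_of_nonneg p1]
  refine le_csInf n2.smul_set ?_
  rintro _ ⟨D, hD, rfl⟩
  exact step D hD
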